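/- (Soundness of S1+SP) For every set of modal formulas Φ and every modal formula φ: if Φ ⊢ φ in S1+SP, then Φ ⊨ φ, i.e., every interpretation (M,γ) satisfying all formulas of Φ satisfies φ. -/

import Mathlib

/-- Modal formulas over countably many propositional variables x₀, x₁, …. -/
inductive Fm : Type
  | var : ℕ → Fm
  | neg : Fm → Fm
  | imp : Fm → Fm → Fm
  | box : Fm → Fm
deriving DecidableEq

namespace Fm

/-- ⊤ := x₀ → x₀ -/
def top : Fm := imp (var 0) (var 0)

/-- φ ∧ ψ := ¬(φ → ¬ψ) -/
def conj (φ ψ : Fm) : Fm := neg (imp φ (neg ψ))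

/-- φ ↔ ψ := (φ → ψ) ∧ (ψ → φ) -/
def biimp (φ ψ : Fm) : Fm := conj (imp φ ψ) (imp ψ φ)

/-- strict equivalence: φ ≡ ψ := □(φ → ψ) ∧ □(ψ → φ) -/
def equiv (φ ψ : Fm) : Fm := conj (box (imp φ ψ)) (box (imp ψ φ))

/-- φ[x := ψ]: substitution of ψ for all occurrences of the variable x in φ. -/
def subst (φ : Fm) (x : ℕ) (ψ : Fm) : Fm :=
  match φ with
  | var y => if y = x then ψ else var y
  | neg χ => neg (subst χ x ψ)
  | imp χ δ => imp (subst χ x ψ) (subst δ x ψ)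
  | box χ => box (subst χ x ψ)

/-- Propositional (two-valued) evaluation of a modal formula, treating
variables and boxed formulas as atoms. -/
def pEval (v : Fm → Bool) : Fm → Bool
  | var n => v (var n)
  | neg φ => !(pEval v φ)
  | imp φ ψ => !(pEval v φ) || pEval v ψ
  | box φ => v (box φ)

/-- φ has the form of a propositional tautology, i.e. φ is a substitution
instance of a propositional tautology. -/
def isTautInstance (φ : Fm) : Prop := ∀ v : Fm → Bool, pEval v φ = true

/-- The axioms (i)–(iii) of Lewis system S1 (Lemmon-style). -/
inductive S1Axiom : Fm → Prop
  | taut {φ} : isTautInstance φ → S1Axiom φ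
  | ax2 (φ) : S1Axiom (imp (box φ) φ)
  | ax3 (φ ψ χ) :
      S1Axiom (imp (conj (box (imp φ ψ)) (box (imp ψ χ))) (box (imp φ χ)))

/-- The identity axioms (iv)–(vi), i.e. the Substitution Principle SP. -/
inductive SPAxiom : Fm → Prop
  | ax4 (φ ψ) : SPAxiom (imp (equiv φ ψ) (equiv (neg φ) (neg ψ)))
  | ax5 (φ ψ φ' ψ') :
      SPAxiom (imp (conj (equiv φ ψ) (equiv φ' ψ'))
        (equiv (imp φ φ') (imp ψ ψ')))
  | ax6 (φ ψ) : SPAxiom (imp (equiv φ ψ) (equiv (box φ) (box ψ)))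

/-- Derivability in S1+SP from a set Φ of premises: axioms (i)–(vi),
modus ponens, and Axiom Necessitation AN restricted to axioms (i)–(iii). -/
inductive S1SP : Set Fm → Fm → Prop
  | prem {Φ φ} : φ ∈ Φ → S1SP Φ φ
  | axm {Φ φ} : S1Axiom φ → S1SP Φ φ
  | spAxm {Φ φ} : SPAxiom φ → S1SP Φ φ
  | mp {Φ φ ψ} : S1SP Φ (imp φ ψ) → S1SP Φ φ → S1SP Φ ψ
  | an {Φ φ} : S1Axiom φ → S1SP Φ (box φ)

end Fm

/-- An algebraic model: a Boolean algebra (with complement `ᶜ` and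
implication `⇨`), a set TRUE of true propositions, and a unary operation f□,
satisfying the model conditions (1)–(6). -/
structure MModel where
  M : Type
  [ba : BooleanAlgebra M]
  TRUE : Set M
  fbox : M → M
  bot_not_true : ⊥ ∉ TRUE
  top_true : ⊤ ∈ TRUE
  compl_true : ∀ m : M, mᶜ ∈ TRUE ↔ m ∉ TRUE
  himp_true : ∀ m m' : M, (m ⇨ m') ∈ TRUE ↔ (m ∉ TRUE ∨ m' ∈ TRUE)
  fbox_true : ∀ m : M, fbox m ∈ TRUE ↔ m = ⊤
  fbox_le : ∀ m : M, fbox m ≤ m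
  fbox_trans : ∀ m m' m'' : M,
    fbox (m ⇨ m') ⊓ fbox (m' ⇨ m'') ≤ fbox (m ⇨ m'')

attribute [instance] MModel.ba

namespace MModel

/-- The canonical homomorphic extension of an assignment γ of propositions
to the variables. -/
def eval (𝓜 : MModel) (γ : ℕ → 𝓜.M) : Fm → 𝓜.M
  | .var n => γ n
  | .neg φ => (𝓜.eval γ φ)ᶜ
  | .imp φ ψ => 𝓜.eval γ φ ⇨ 𝓜.eval γ ψ
  | .box φ => 𝓜.fbox (𝓜.eval γ φ)

/-- Satisfaction: (𝓜, γ) ⊨ φ iff γ(φ) ∈ TRUE. -/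
def sat (𝓜 : MModel) (γ : ℕ → 𝓜.M) (φ : Fm) : Prop := 𝓜.eval γ φ ∈ 𝓜.TRUE

end MModel

theorem prime_sep {α : Type} [BooleanAlgebra α] (a : α) (ha : a ≠ ⊤) :
    ∃ I : Order.Ideal α, I.IsPrime ∧ a ∈ I := by
  have hd : Disjoint ((Order.PFilter.principal (⊤ : α) : Order.PFilter α) : Set α)
      ((Order.Ideal.principal a : Order.Ideal α) : Set α) := by
    rw [Set.disjoint_left]
    intro x hx hx'
    have h1 : (⊤ : α) ≤ x := hx
    have h2 : x ≤ a := hx'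
    exact ha (top_le_iff.mp (h1.trans h2))
  obtain ⟨J, hJ, hle, -⟩ := DistribLattice.prime_ideal_of_disjoint_filter_ideal hd
  exact ⟨J, hJ, hle (le_refl a)⟩

open Fm in
theorem taut_eval (𝓜 : MModel) (γ : ℕ → 𝓜.M) (φ : Fm) (h : isTautInstance φ) :
    𝓜.eval γ φ = ⊤ := by
  classical
  by_contra hne
  obtain ⟨I, hI, hmem⟩ := prime_sep _ hne
  have hc : ∀ x : 𝓜.M, xᶜ ∈ I ↔ x ∉ I := by
    intro x
    constructor
    · intro h1 h2
      have := I.sup_mem h2 h1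
      rw [sup_compl_eq_top] at this
      exact hI.toIsProper.top_notMem this
    · intro h1
      exact (hI.mem_or_compl_mem (x := x)).resolve_left h1
  have key : ∀ ψ : Fm, pEval (fun χ => decide (𝓜.eval γ χ ∉ I)) ψ = true ↔ 𝓜.eval γ ψ ∉ I := by
    intro ψ
    induction ψ with
    | var n => simp [pEval]
    | box ψ ih => simp [pEval]
    | neg ψ ih =>
      simp only [pEval, MModel.eval, hc, ← ih]
      simp
    | imp ψ χ ih1 ih2 =>
      simp only [pEval, MModel.eval, himp_eq, Order.Ideal.sup_mem_iff, hc,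
        Bool.or_eq_true, Bool.not_eq_true', ← Bool.not_eq_true, ih1, ih2]
      tauto
  exact (key φ).mp (h _) hmem

theorem conj_eval (𝓜 : MModel) (γ : ℕ → 𝓜.M) (φ ψ : Fm) :
    𝓜.eval γ (Fm.conj φ ψ) = 𝓜.eval γ φ ⊓ 𝓜.eval γ ψ := by
  simp [Fm.conj, MModel.eval, himp_eq, inf_comm]

theorem conj_sat (𝓜 : MModel) (γ : ℕ → 𝓜.M) (φ ψ : Fm) :
    𝓜.eval γ (Fm.conj φ ψ) ∈ 𝓜.TRUE ↔ 𝓜.eval γ φ ∈ 𝓜.TRUE ∧ 𝓜.eval γ ψ ∈ 𝓜.TRUE := by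
  simp only [Fm.conj, MModel.eval, 𝓜.compl_true, 𝓜.himp_true]
  tauto

theorem equiv_sat (𝓜 : MModel) (γ : ℕ → 𝓜.M) (φ ψ : Fm) :
    𝓜.eval γ (Fm.equiv φ ψ) ∈ 𝓜.TRUE ↔ 𝓜.eval γ φ = 𝓜.eval γ ψ := by
  rw [Fm.equiv, conj_sat]
  simp only [MModel.eval, 𝓜.fbox_true, himp_eq_top_iff]
  exact ⟨fun h => le_antisymm h.1 h.2, fun h => ⟨h.le, h.ge⟩⟩

theorem imp_sat (𝓜 : MModel) (γ : ℕ → 𝓜.M) (φ ψ : Fm) :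
    𝓜.eval γ (Fm.imp φ ψ) ∈ 𝓜.TRUE ↔ (𝓜.eval γ φ ∈ 𝓜.TRUE → 𝓜.eval γ ψ ∈ 𝓜.TRUE) := by
  simp only [MModel.eval, 𝓜.himp_true]
  tauto

theorem s1_eval (𝓜 : MModel) (γ : ℕ → 𝓜.M) (φ : Fm) (h : Fm.S1Axiom φ) :
    𝓜.eval γ φ = ⊤ := by
  cases h with
  | taut h => exact taut_eval 𝓜 γ φ h
  | ax2 φ => exact himp_eq_top_iff.mpr (𝓜.fbox_le _)
  | ax3 φ ψ χ =>
    rw [MModel.eval, himp_eq_top_iff, conj_eval]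
    exact 𝓜.fbox_trans _ _ _

open Fm in
/-- Soundness of S1+SP. -/
theorem soundness (Φ : Set Fm) (φ : Fm) (h : S1SP Φ φ) :
    ∀ (𝓜 : MModel) (γ : ℕ → 𝓜.M), (∀ χ ∈ Φ, 𝓜.sat γ χ) → 𝓜.sat γ φ := by
  intro 𝓜 γ hΦ
  induction h with
  | prem h => exact hΦ _ h
  | axm h =>
    rw [MModel.sat, s1_eval 𝓜 γ _ h]
    exact 𝓜.top_true
  | spAxm h =>
    rw [MModel.sat]
    cases h with
    | ax4 φ ψ =>
      rw [imp_sat, equiv_sat, equiv_sat]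
      intro h
      simp only [MModel.eval, h]
    | ax5 φ ψ φ' ψ' =>
      rw [imp_sat, conj_sat, equiv_sat, equiv_sat, equiv_sat]
      rintro ⟨h, h'⟩
      simp only [MModel.eval, h, h']
    | ax6 φ ψ =>
      rw [imp_sat, equiv_sat, equiv_sat]
      intro h
      simp only [MModel.eval, h]
  | mp _ _ ih1 ih2 => exact (imp_sat 𝓜 γ _ _).mp ih1 ih2
  | an h => exact (𝓜.fbox_true _).mpr (s1_eval 𝓜 γ _ h)
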